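/- Suppose α is an isophote with axis d and angle θ, κ(s) > 0 for all s, and k_g(s) = 0 for all s (α is a geodesic). Then the function s ↦ ⟪n(s), d⟫ is constant with ⟪n(s), d⟫² = cos²θ for all s (so α is a slant helix with axis d), and for all s: (κ(s)² + τ(s)²)·⟪T(s), d⟫² = τ(s)²·sin²θ and (κ(s)² + τ(s)²)·⟪b(s), d⟫² = κ(s)²·sin²θ. -/

import Mathlib

open scoped RealInnerProductSpace

noncomputable section

/-- The cross product on `EuclideanSpace ℝ (Fin 3)`. -/
def cross3 (u v : EuclideanSpace ℝ (Fin 3)) : EuclideanSpace ℝ (Fin 3) :=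
  (EuclideanSpace.equiv (Fin 3) ℝ).symm
    (crossProduct ((EuclideanSpace.equiv (Fin 3) ℝ) u) ((EuclideanSpace.equiv (Fin 3) ℝ) v))

theorem inner_eq_sum_coords (u v : EuclideanSpace ℝ (Fin 3)) :
    ⟪u, v⟫ = u 0 * v 0 + u 1 * v 1 + u 2 * v 2 := by
  simp only [PiLp.inner_apply, Fin.sum_univ_three, RCLike.inner_apply, conj_trivial]
  ring

theorem inner_cross3 (u v w : EuclideanSpace ℝ (Fin 3)) :
    ⟪cross3 u v, w⟫ = (u 1 * v 2 - u 2 * v 1) * w 0 + (u 2 * v 0 - u 0 * v 2) * w 1 +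
      (u 0 * v 1 - u 1 * v 0) * w 2 := by
  simp [inner_eq_sum_coords, cross3, cross_apply]

theorem inner_cross3_self_left (u v : EuclideanSpace ℝ (Fin 3)) : ⟪cross3 u v, u⟫ = 0 := by
  rw [inner_cross3]; ring

theorem inner_cross3_self_right (u v : EuclideanSpace ℝ (Fin 3)) : ⟪cross3 u v, v⟫ = 0 := by
  rw [inner_cross3]; ring

theorem inner_cross3_swap (u v w : EuclideanSpace ℝ (Fin 3)) :
    ⟪cross3 u v, w⟫ = -⟪cross3 v u, w⟫ := by
  rw [inner_cross3, inner_cross3]; ring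

theorem inner_cross3_smul_right (c : ℝ) (u v w : EuclideanSpace ℝ (Fin 3)) :
    ⟪cross3 u (c • v), w⟫ = c * ⟪cross3 u v, w⟫ := by
  simp only [inner_cross3, PiLp.smul_apply, smul_eq_mul]; ring

theorem inner_cross3_cross3 (u v : EuclideanSpace ℝ (Fin 3)) :
    ⟪cross3 u v, cross3 u v⟫ = ⟪u, u⟫ * ⟪v, v⟫ - ⟪u, v⟫ ^ 2 := by
  simp only [inner_eq_sum_coords, cross3, cross_apply]
  simp
  ring

theorem orthonormal_cross3 {u v : EuclideanSpace ℝ (Fin 3)} (hu : ‖u‖ = 1) (hv : ‖v‖ = 1)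
    (huv : ⟪u, v⟫ = 0) : Orthonormal ℝ ![u, v, cross3 u v] := by
  have hc : ‖cross3 u v‖ = 1 := by
    have h := inner_cross3_cross3 u v
    rw [huv, real_inner_self_eq_norm_sq, real_inner_self_eq_norm_sq, real_inner_self_eq_norm_sq,
      hu, hv] at h
    exact (sq_eq_sq₀ (norm_nonneg _) zero_le_one).mp (by linarith)
  have hcu := inner_cross3_self_left u v
  have hcv := inner_cross3_self_right u v
  refine ⟨fun i => by fin_cases i <;> simp [hu, hv, hc], fun i j hij => ?_⟩
  fin_cases i <;> fin_cases j <;>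
    first
    | exact absurd rfl hij
    | simpa [real_inner_comm] using huv
    | simpa [real_inner_comm] using hcu
    | simpa [real_inner_comm] using hcv

/-- An orthonormal pair completed by its cross product is an orthonormal basis of `ℝ³`. -/
def orthonormalBasisCross3 {u v : EuclideanSpace ℝ (Fin 3)} (hu : ‖u‖ = 1) (hv : ‖v‖ = 1)
    (huv : ⟪u, v⟫ = 0) : OrthonormalBasis (Fin 3) ℝ (EuclideanSpace ℝ (Fin 3)) :=
  OrthonormalBasis.mk (orthonormal_cross3 hu hv huv)
    ((orthonormal_cross3 hu hv huv).linearIndependent.span_eq_top_of_card_eq_finrank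
      (by simp)).ge

theorem inner_eq_sum_inner_cross3 {u v : EuclideanSpace ℝ (Fin 3)} (hu : ‖u‖ = 1) (hv : ‖v‖ = 1)
    (huv : ⟪u, v⟫ = 0) (x y : EuclideanSpace ℝ (Fin 3)) :
    ⟪x, y⟫ = ⟪u, x⟫ * ⟪u, y⟫ + ⟪v, x⟫ * ⟪v, y⟫ + ⟪cross3 u v, x⟫ * ⟪cross3 u v, y⟫ := by
  rw [← (orthonormalBasisCross3 hu hv huv).sum_inner_mul_inner x y, Fin.sum_univ_three]
  simp [orthonormalBasisCross3, real_inner_comm]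

theorem inner_deriv_self_eq_zero {f : ℝ → EuclideanSpace ℝ (Fin 3)} (hf : Differentiable ℝ f)
    (hunit : ∀ s, ‖f s‖ = 1) (s : ℝ) : ⟪f s, deriv f s⟫ = 0 := by
  have h := (hf s).hasDerivAt.inner ℝ (hf s).hasDerivAt
  have hc : (fun t => ⟪f t, f t⟫) = fun _ => (1 : ℝ) := by
    funext t; rw [real_inner_self_eq_norm_sq, hunit, one_pow]
  rw [hc] at h
  have := h.unique (hasDerivAt_const s 1)
  rw [real_inner_comm (f s) (deriv f s)] at this
  linarith

theorem stmt4
    (α N : ℝ → EuclideanSpace ℝ (Fin 3))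
    (hα : ContDiff ℝ (⊤ : ℕ∞) α) (hN : ContDiff ℝ (⊤ : ℕ∞) N)
    (hunit : ∀ s, ‖deriv α s‖ = 1)
    (hNunit : ∀ s, ‖N s‖ = 1)
    (hNT : ∀ s, ⟪N s, deriv α s⟫ = 0)
    (T B : ℝ → EuclideanSpace ℝ (Fin 3))
    (hT : ∀ s, T s = deriv α s)
    (hB : ∀ s, B s = cross3 (N s) (T s))
    (kn kg τg : ℝ → ℝ)
    (hkn : ∀ s, kn s = ⟪deriv T s, N s⟫)
    (hkg : ∀ s, kg s = ⟪deriv T s, B s⟫)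
    (hτg : ∀ s, τg s = ⟪deriv B s, N s⟫)
    (κ τ : ℝ → ℝ) (n b : ℝ → EuclideanSpace ℝ (Fin 3))
    (hκ : ∀ s, κ s = ‖deriv (deriv α) s‖)
    (hκpos : ∀ s, 0 < κ s)
    (hn : ∀ s, n s = (κ s)⁻¹ • deriv (deriv α) s)
    (hb : ∀ s, b s = cross3 (deriv α s) (n s))
    (hτ : ∀ s, τ s = ⟪cross3 (deriv α s) (deriv (deriv α) s), deriv (deriv (deriv α)) s⟫ / κ s ^ 2)
    (d : EuclideanSpace ℝ (Fin 3)) (hd : ‖d‖ = 1) (θ : ℝ)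
    (hiso : ∀ s, ⟪N s, d⟫ = Real.cos θ)
    (hgeo : ∀ s, kg s = 0) :
    (∀ s t, ⟪n s, d⟫ = ⟪n t, d⟫) ∧ (∀ s, ⟪n s, d⟫ ^ 2 = Real.cos θ ^ 2) ∧
      ∀ s, (κ s ^ 2 + τ s ^ 2) * ⟪T s, d⟫ ^ 2 = τ s ^ 2 * Real.sin θ ^ 2 ∧
        (κ s ^ 2 + τ s ^ 2) * ⟪b s, d⟫ ^ 2 = κ s ^ 2 * Real.sin θ ^ 2 := by
  obtain rfl : T = deriv α := funext hT
  have hT' : ContDiff ℝ (⊤ : ℕ∞) (deriv α) := (contDiff_infty_iff_deriv.mp hα).2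
  have hA' : ContDiff ℝ (⊤ : ℕ∞) (deriv (deriv α)) := (contDiff_infty_iff_deriv.mp hT').2
  have hTd : Differentiable ℝ (deriv α) := hT'.differentiable (by simp)
  have hAd : Differentiable ℝ (deriv (deriv α)) := hA'.differentiable (by simp)
  have hNd : Differentiable ℝ N := hN.differentiable (by simp)
  have hknd : Differentiable ℝ kn := by
    rw [funext hkn]; exact hAd.inner ℝ hNd
  have hAT s := inner_deriv_self_eq_zero hTd hunit s
  have hAN s : deriv (deriv α) s = kn s • N s := by
    refine ext_inner_left ℝ fun x => ?_
    have hB0 : ⟪cross3 (N s) (deriv α s), deriv (deriv α) s⟫ = 0 := by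
      rw [← hB, real_inner_comm, ← hkg, hgeo]
    rw [inner_eq_sum_inner_cross3 (hNunit s) (hunit s) (hNT s) x, hAT, hB0, inner_smul_right, hkn,
      real_inner_comm x, real_inner_comm (deriv (deriv α) s)]
    ring
  have hsq s : kn s ^ 2 = κ s ^ 2 := by
    rw [hκ, hAN, norm_smul, hNunit, mul_one, Real.norm_eq_abs, sq_abs]
  have hκc : Continuous κ := by
    rw [funext hκ]; exact hAd.continuous.norm
  obtain ⟨ε, hε, hεκ⟩ : ∃ ε : ℝ, ε ^ 2 = 1 ∧ ∀ s, kn s = ε * κ s := by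
    rcases isPreconnected_univ.eq_or_eq_neg_of_sq_eq hknd.continuous.continuousOn
      hκc.continuousOn (fun s _ => hsq s) (fun _ => (hκpos _).ne') with h | h
    · exact ⟨1, by norm_num, fun s => by simpa using h (Set.mem_univ s)⟩
    · exact ⟨-1, by norm_num, fun s => by simpa using h (Set.mem_univ s)⟩
  have hnN s : n s = ε • N s := by
    rw [hn, hAN, hεκ, smul_smul]
    congr 1
    field_simp [(hκpos s).ne']
  have hnd s : ⟪n s, d⟫ = ε * Real.cos θ := by rw [hnN, real_inner_smul_left, hiso]
  refine ⟨fun s t => by rw [hnd, hnd], fun s => by rw [hnd, mul_pow, hε, one_mul], fun s => ?_⟩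
  have hN'N := inner_deriv_self_eq_zero hNd hNunit s
  have hN'T : ⟪deriv α s, deriv N s⟫ = -kn s := by
    have h := (hNd s).hasDerivAt.inner ℝ (hTd s).hasDerivAt
    rw [funext hNT] at h
    have h0 := h.unique (hasDerivAt_const s 0)
    rw [real_inner_comm (deriv α s), real_inner_comm (deriv (deriv α) s), ← hkn] at h0
    linarith
  have hN'd : ⟪deriv N s, d⟫ = 0 := by
    have h := (hNd s).hasDerivAt.inner ℝ (hasDerivAt_const s d)
    rw [funext hiso] at h
    have h0 := h.unique (hasDerivAt_const s _)
    simpa using h0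
  have hA'' : deriv (deriv (deriv α)) s = kn s • deriv N s + deriv kn s • N s := by
    rw [funext hAN]
    exact ((hknd s).hasDerivAt.smul (hNd s).hasDerivAt).deriv
  have hτB : ⟪cross3 (N s) (deriv α s), deriv N s⟫ = -τ s := by
    rw [hτ, hA'', hAN, inner_cross3_smul_right, inner_cross3_swap, inner_add_right,
      inner_smul_right, inner_smul_right, inner_cross3_self_right, ← hsq]
    have : kn s ≠ 0 := fun h => (hκpos s).ne' (by simpa [h] using (hsq s).symm)
    field_simp
    ring
  have hbd : ⟪b s, d⟫ ^ 2 = ⟪cross3 (N s) (deriv α s), d⟫ ^ 2 := by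
    rw [hb, hnN, inner_cross3_smul_right, inner_cross3_swap, mul_pow, hε]
    ring
  have hrel := inner_eq_sum_inner_cross3 (hNunit s) (hunit s) (hNT s) (deriv N s) d
  rw [hN'd, hN'N, hN'T, hτB] at hrel
  have hdd := inner_eq_sum_inner_cross3 (hNunit s) (hunit s) (hNT s) d d
  rw [real_inner_self_eq_norm_sq, hd, hiso] at hdd
  rw [hbd, ← hsq, Real.sin_sq]
  generalize ⟪deriv α s, d⟫ = t at *
  generalize ⟪cross3 (N s) (deriv α s), d⟫ = β at *
  have hsin : 1 - Real.cos θ ^ 2 = t ^ 2 + β ^ 2 := by linarith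
  have hkt : kn s * t = -(τ s * β) := by linarith
  have hkt2 : kn s ^ 2 * t ^ 2 = τ s ^ 2 * β ^ 2 := by
    rw [← mul_pow, hkt, neg_sq, mul_pow]
  rw [hsin]
  constructor <;> linarith
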